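/- Let $(c_n)_{n \in \mathbb{Z}}$ be complex numbers with $|c_n| \leq K/|n|$ for all $n \neq 0$ and some constant $K$, and suppose $f \in C([0,1])$ is a continuous periodic function whose Fourier coefficients are $(c_n)$. Then the symmetric partial sums $S_N(t) = \sum_{|n| \leq N} c_n e^{2\pi i n t}$ converge to $f$ uniformly on $[0,1]$ as $N \to \infty$. -/

import Mathlib

open Complex

namespace FUC
open MeasureTheory AddCircle

abbrev E := C(AddCircle (1:ℝ), ℂ)

noncomputable def S (N : ℕ) (g : E) : E :=
  ∑ n ∈ Finset.Icc (-(N:ℤ)) N, fourierCoeff g n • fourier n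

lemma Icc_succ (a : ℤ → E) (N : ℕ) :
    ∑ n ∈ Finset.Icc (-((N+1:ℕ):ℤ)) ((N+1:ℕ):ℤ), a n =
      (∑ n ∈ Finset.Icc (-(N:ℤ)) N, a n) + (a (N+1) + a (-(N+1))) := by
  have : Finset.Icc (-((N+1:ℕ):ℤ)) ((N+1:ℕ):ℤ) =
      insert ((N:ℤ)+1) (insert (-((N:ℤ)+1)) (Finset.Icc (-(N:ℤ)) N)) := by
    ext x; simp only [Finset.mem_Icc, Finset.mem_insert]; push_cast; omega
  rw [this, Finset.sum_insert, Finset.sum_insert]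
  · abel
  · simp only [Finset.mem_Icc]; omega
  · simp only [Finset.mem_Icc, Finset.mem_insert]; omega

lemma sum_row (a : ℤ → E) (N : ℕ) :
    ∑ n ∈ Finset.Icc (-(N:ℤ)) N, a n =
      (∑ j ∈ Finset.range N, a (j - N)) + (∑ l ∈ Finset.range N, a (N - l)) + a 0 := by
  induction N with
  | zero => simp
  | succ N ih =>
    rw [Icc_succ, ih, Finset.sum_range_succ' _ N, Finset.sum_range_succ' _ N]
    push_cast
    simp only [add_sub_add_right_eq_sub, zero_sub, sub_zero]
    abel

lemma fejer_id (a : ℤ → E) (N : ℕ) :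
    ∑ k ∈ Finset.range N, ∑ n ∈ Finset.Icc (-(k:ℤ)) k, a n =
      ∑ j ∈ Finset.range N, ∑ l ∈ Finset.range N, a (j - l) := by
  induction N with
  | zero => simp
  | succ N ih =>
    rw [Finset.sum_range_succ, ih, sum_row, Finset.sum_range_succ]
    simp only [Finset.sum_range_succ, Finset.sum_add_distrib, sub_self]
    abel

lemma cint (u : E) : Integrable (fun t => u t) haarAddCircle :=
    (u.continuous).integrable_of_hasCompactSupport
      (HasCompactSupport.of_compactSpace _)

lemma add_sm (a b : ℂ) (u : E) : (a + b) • u = a • u + b • u := add_smul a b u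
lemma sub_sm (a b : ℂ) (u : E) : (a - b) • u = a • u - b • u := sub_smul a b u
lemma zero_sm (u : E) : (0:ℂ) • u = 0 := zero_smul ℂ u

lemma coeff_sub (g h : E) (n : ℤ) : fourierCoeff (g - h : E) n = fourierCoeff g n - fourierCoeff h n := by
  have hi (u : E) : Integrable (fun t => fourier (-n) t • u t) haarAddCircle :=
    cint ⟨fun t => (fourier (-n) t : ℂ) • u t, by fun_prop⟩
  unfold fourierCoeff
  rw [← integral_sub (hi g) (hi h)]
  simp [mul_sub]

lemma S_sub (N : ℕ) (g h : E) : S N (g - h) = S N g - S N h := by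
  simp only [S, coeff_sub, sub_sm, Finset.sum_sub_distrib]

lemma coeff_add (g h : E) (n : ℤ) : fourierCoeff (g + h : E) n = fourierCoeff g n + fourierCoeff h n := by
  have := coeff_sub (g + h) h n
  rw [add_sub_cancel_right] at this
  rw [this]; ring

lemma S_poly (p : E) (hp : p ∈ Submodule.span ℂ (Set.range (@fourier (1:ℝ)))) :
    ∃ N0, ∀ N ≥ N0, S N p = p := by
  induction hp using Submodule.span_induction with
  | mem x hx =>
    obtain ⟨m, rfl⟩ := hx
    refine ⟨m.natAbs, fun N hN => ?_⟩
    unfold S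
    rw [Finset.sum_eq_single m]
    · rw [fourierCoeff_fourier]; simp
    · intro b _ hb
      rw [fourierCoeff_fourier]; rw [Pi.single_eq_of_ne hb, zero_sm]
    · intro h; exfalso; apply h; rw [Finset.mem_Icc]; omega
  | zero => 
    refine ⟨0, fun N _ => ?_⟩
    simp [S, fourierCoeff, zero_sm]
  | add x y _ _ hx hy =>
    obtain ⟨a, ha⟩ := hx
    obtain ⟨b, hb⟩ := hy
    refine ⟨max a b, fun N hN => ?_⟩
    have : S N (x + y) = S N x + S N y := by
      simp only [S, coeff_add, add_sm, Finset.sum_add_distrib]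
    rw [this, ha N (le_of_max_le_left hN), hb N (le_of_max_le_right hN)]
  | smul r x _ hx =>
    obtain ⟨a, ha⟩ := hx
    refine ⟨a, fun N hN => ?_⟩
    have : S N (r • x) = r • S N x := by
      simp only [S, Finset.smul_sum, smul_smul]
      refine Finset.sum_congr rfl fun n _ => ?_
      rw [ContinuousMap.coe_smul, fourierCoeff.const_smul, smul_eq_mul]
    rw [this, ha N hN]

lemma S_step (g : E) (K : ℝ) (hK : 0 ≤ K) (hd : ∀ n : ℤ, n ≠ 0 → ‖fourierCoeff g n‖ ≤ K / |(n:ℝ)|)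
    (N : ℕ) (hN : 0 < N) (k : ℕ) : ‖S (N + k) g - S N g‖ ≤ k * (2 * K / N) := by
  induction k with
  | zero => simp
  | succ k ih =>
    have hb : ∀ n : ℤ, (N:ℝ) ≤ |(n:ℝ)| → ‖fourierCoeff g n • (fourier n : E)‖ ≤ K / N := by
      intro n hn
      have hN' : (0:ℝ) < N := by exact_mod_cast hN
      rw [norm_smul, fourier_norm, mul_one]
      refine (hd n ?_).trans (by gcongr)
      rintro rfl
      simp at hn; omega
    have h1 : S (N + (k+1)) g - S N g = (S (N+k) g - S N g) + 
       (fourierCoeff g (((N+k:ℕ):ℤ)+1) • fourier (((N+k:ℕ):ℤ)+1)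
         + fourierCoeff g (-(((N+k:ℕ):ℤ)+1)) • fourier (-(((N+k:ℕ):ℤ)+1))) := by
      rw [← add_assoc]
      unfold S
      rw [Icc_succ]; abel
    rw [h1]
    have habs : (N:ℝ) ≤ |((((N+k:ℕ):ℤ)+1 : ℤ):ℝ)| := by
      refine le_trans ?_ (le_abs_self _)
      push_cast
      linarith [(Nat.cast_nonneg k : (0:ℝ) ≤ k)]
    refine (norm_add_le _ _).trans ?_
    have h2 := hb _ habs
    have h3 := hb (-(((N+k:ℕ):ℤ)+1)) (by rw [Int.cast_neg, abs_neg]; exact habs)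
    have h4 := norm_add_le (fourierCoeff g (((N+k:ℕ):ℤ)+1) • (fourier (((N+k:ℕ):ℤ)+1) : E))
         (fourierCoeff g (-(((N+k:ℕ):ℤ)+1)) • (fourier (-(((N+k:ℕ):ℤ)+1)) : E))
    have h5 : ((k+1:ℕ):ℝ) * (2 * K / N) = k * (2 * K / N) + (K / N + K / N) := by push_cast; ring
    rw [h5]
    linarith

lemma int_fourier (n : ℤ) : ∫ t : AddCircle (1:ℝ), fourier n t ∂haarAddCircle = if n = 0 then 1 else 0 := by
  have := congrFun (fourierCoeff_fourier (T := 1) n) 0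
  unfold fourierCoeff at this
  simp [Pi.single_apply] at this
  simp [this, eq_comm]

lemma fejer_sq (N : ℕ) (u : AddCircle (1:ℝ)) : 
   ∑ j ∈ Finset.range N, ∑ l ∈ Finset.range N, (fourier ((j:ℤ) - l) u : ℂ)
     = ((‖∑ j ∈ Finset.range N, (fourier (j:ℤ) u : ℂ)‖^2 : ℝ) : ℂ) := by
  rw [← Complex.normSq_eq_norm_sq, ← Complex.mul_conj, map_sum, Finset.sum_mul_sum]
  simp only [← fourier_neg, ← fourier_add, sub_eq_add_neg]

noncomputable def ker (N : ℕ) : E :=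
  ∑ j ∈ Finset.range N, ∑ l ∈ Finset.range N, fourier ((j:ℤ) - l)

lemma ker_apply (N : ℕ) (u) : ker N u = ∑ j ∈ Finset.range N, ∑ l ∈ Finset.range N, (fourier ((j:ℤ) - l) u : ℂ) := by
  simp [ker, ContinuousMap.sum_apply]

lemma int_ker (N : ℕ) : ∫ t : AddCircle (1:ℝ), ‖ker N t‖ ∂haarAddCircle = N := by
  have h1 : ∀ t, ((‖ker N t‖ : ℝ) : ℂ) = ker N t := by
    intro t
    rw [ker_apply, fejer_sq, Complex.norm_real, Real.norm_of_nonneg (by positivity)]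
  apply Complex.ofReal_injective
  rw [← integral_complex_ofReal]
  simp only [h1]
  simp only [ker_apply]
  rw [integral_finsetSum _ (fun j _ => integrable_finsetSum _ fun l _ => cint _)]
  have : ∀ j ∈ Finset.range N, ∫ t : AddCircle (1:ℝ), ∑ l ∈ Finset.range N, (fourier ((j:ℤ) - l) t : ℂ) ∂haarAddCircle = 1 := by
    intro j hj
    rw [integral_finsetSum _ (fun l _ => cint _)]
    simp only [int_fourier, sub_eq_zero, Nat.cast_inj]
    simp [Finset.mem_range.1 hj]
  rw [Finset.sum_congr rfl this]; simp

lemma fejer_bound (g : E) (N : ℕ) : ‖∑ k ∈ Finset.range N, S k g‖ ≤ N * ‖g‖ := by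
  unfold S
  rw [fejer_id (fun n => fourierCoeff g n • fourier n)]
  rw [ContinuousMap.norm_le _ (by positivity)]
  intro x
  have hc (n : ℤ) : fourierCoeff g n * (fourier n x : ℂ) = ∫ t, g t * fourier n (x - t) ∂haarAddCircle := by
    unfold fourierCoeff
    rw [← integral_mul_const]
    congr 1; ext t
    have : (fourier n (x - t) : ℂ) = fourier n x * fourier (-n) t := by
      simp only [fourier_apply, sub_eq_add_neg, smul_add, toCircle_add, Circle.coe_mul, smul_neg, neg_smul]
    rw [this, smul_eq_mul]; ring
  have hi (n : ℤ) : Integrable (fun t => g t * (fourier n (x - t) : ℂ)) haarAddCircle :=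
    cint ⟨fun t => g t * (fourier n (x - t) : ℂ), by fun_prop⟩
  have key : (∑ j ∈ Finset.range N, ∑ l ∈ Finset.range N, fourierCoeff g ((j:ℤ) - l) • (fourier ((j:ℤ) - l) : E)) x
      = ∫ t, g t * ker N (x - t) ∂haarAddCircle := by
    simp only [ContinuousMap.sum_apply, ContinuousMap.smul_apply, smul_eq_mul, hc, ker_apply, Finset.mul_sum]
    rw [integral_finsetSum _ (fun j _ => integrable_finsetSum _ fun l _ => hi _)]
    refine Finset.sum_congr rfl fun j _ => ?_
    rw [integral_finsetSum _ (fun l _ => hi _)]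
  rw [key]
  refine (norm_integral_le_integral_norm _).trans ?_
  have hk : Integrable (fun t => ‖ker N (x - t)‖) haarAddCircle :=
    (cint ⟨fun t => ker N (x - t), by fun_prop⟩).norm
  calc ∫ t, ‖g t * ker N (x - t)‖ ∂haarAddCircle ≤ ∫ t, ‖g‖ * ‖ker N (x - t)‖ ∂haarAddCircle := by
        refine integral_mono (cint ⟨fun t => g t * ker N (x - t), by fun_prop⟩).norm (hk.const_mul _) fun t => ?_
        simp only [norm_mul]
        gcongr
        exact g.norm_coe_le_norm t
    _ = N * ‖g‖ := by
        rw [integral_const_mul, integral_sub_left_eq_self (fun t => ‖ker N t‖) haarAddCircle x, int_ker, mul_comm]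

lemma main_bound (g : E) (K : ℝ) (hK : 0 ≤ K) (hd : ∀ n : ℤ, n ≠ 0 → ‖fourierCoeff g n‖ ≤ K / |(n:ℝ)|)
    (p : E) (N M : ℕ) (hN : 0 < N) (hp : ∀ k ≥ N, S k p = p) :
    M * ‖S N g - g‖ ≤ (2 * N + 2 * M) * ‖g - p‖ + M * (M * (2 * K / N)) := by
  have e : (M:ℂ) • (S N g - g) = (∑ k ∈ Finset.range (N+M), S k (g-p)) - (∑ k ∈ Finset.range N, S k (g-p))
      - (M:ℂ) • (g - p) - ∑ k ∈ Finset.range M, (S (N+k) g - S N g) := by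
    rw [Finset.sum_range_add]
    have : ∀ k, S (N+k) (g-p) = S (N+k) g - p := fun k => by rw [S_sub, hp (N+k) (by omega)]
    simp only [this, Finset.sum_sub_distrib, Finset.sum_const, Finset.card_range, Nat.cast_smul_eq_nsmul, smul_sub]
    abel
  have e2 : ‖(M:ℂ) • (S N g - g)‖ = M * ‖S N g - g‖ := by rw [norm_smul]; simp
  rw [← e2, e]
  have b1 := fejer_bound (g-p) (N+M)
  have b2 := fejer_bound (g-p) N
  have b3 : ‖(M:ℂ) • (g-p)‖ = M * ‖g-p‖ := by rw [norm_smul]; simp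
  have b4 : ‖∑ k ∈ Finset.range M, (S (N+k) g - S N g)‖ ≤ M * (M * (2 * K / N)) := by
    refine (norm_sum_le_of_le _ (fun k hk => (S_step g K hK hd N hN k).trans (?_ : _ ≤ M * (2 * K / N)))).trans (by simp)
    gcongr
    exact (Finset.mem_range.1 hk).le
  refine (norm_sub_le _ _).trans ?_
  refine (add_le_add (norm_sub_le _ _) le_rfl).trans ?_
  refine (add_le_add (add_le_add (norm_sub_le _ _) le_rfl) le_rfl).trans ?_
  push_cast at b1
  rw [b3]
  linarith

lemma conv (g : E) (K : ℝ) (hK : 0 ≤ K) (hd : ∀ n : ℤ, n ≠ 0 → ‖fourierCoeff g n‖ ≤ K / |(n:ℝ)|)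
    (ε : ℝ) (hε : 0 < ε) : ∃ N0, ∀ N ≥ N0, ‖S N g - g‖ < ε := by
  obtain ⟨q, hq⟩ := exists_nat_gt (4 * K / ε)
  have hq0 : (0:ℝ) < q := lt_of_le_of_lt (by positivity) hq
  have hq0' : 0 < q := by exact_mod_cast hq0
  have hmem : g ∈ closure (Submodule.span ℂ (Set.range (@fourier (1:ℝ))) : Set E) := by
    have := span_fourier_closure_eq_top (T := (1:ℝ))
    rw [← Submodule.topologicalClosure_coe, this]; trivial
  obtain ⟨p, hp, hgp⟩ := Metric.mem_closure_iff.1 hmem (ε / (2 * (4 * q + 2))) (by positivity)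
  rw [dist_eq_norm] at hgp
  obtain ⟨N0, hN0⟩ := S_poly p hp
  refine ⟨max N0 q, fun N hN => ?_⟩
  have hNq : q ≤ N := le_of_max_le_right hN
  have hN1 : 0 < N := by omega
  have B := main_bound g K hK hd p N (N / q) hN1 (fun k hk => hN0 k ((le_of_max_le_left hN).trans hk))
  set M := N / q with hM
  have hM0 : 0 < M := Nat.div_pos hNq hq0'
  have h1 : q * M ≤ N := Nat.mul_div_le N q
  have h2 : N ≤ 2 * q * M := by
    have : N < q * (M + 1) := Nat.lt_mul_div_succ N hq0'
    nlinarith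
  have h1' : (q:ℝ) * M ≤ N := by exact_mod_cast h1
  have h2' : (N:ℝ) ≤ 2 * q * M := by exact_mod_cast h2
  have hM' : (0:ℝ) < M := by exact_mod_cast hM0
  have hN' : (0:ℝ) < N := by exact_mod_cast hN1
  have h3 : M * (2 * K / N) < ε / 2 := by
    have : 4 * K < q * ε := by rwa [div_lt_iff₀ hε] at hq
    rw [mul_div_assoc', div_lt_iff₀ hN']
    nlinarith [mul_lt_mul_of_pos_left this hM', mul_le_mul_of_nonneg_left h1' hε.le]
  have h4 : (2 * (N:ℝ) + 2 * M) * ‖g - p‖ ≤ M * (ε / 2) := by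
    have : (2 * (N:ℝ) + 2 * M) ≤ M * (4 * q + 2) := by linarith
    calc _ ≤ (M * (4 * q + 2)) * (ε / (2 * (4 * q + 2))) := by gcongr
      _ = _ := by field_simp
  have h5 : M * ‖S N g - g‖ < M * ε := by nlinarith [mul_lt_mul_of_pos_left h3 hM']
  exact lt_of_mul_lt_mul_left h5 hM'.le

end FUC

/-- If a continuous periodic function has Fourier coefficients bounded by `K/|n|`,
then its symmetric partial Fourier sums converge to it uniformly on `[0,1]`. -/
theorem fourier_uniform_convergence (f : ℝ → ℂ) (hf : ContinuousOn f (Set.Icc 0 1))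
    (hper : f 0 = f 1) (c : ℤ → ℂ) (K : ℝ)
    (hdecay : ∀ n : ℤ, n ≠ 0 → ‖c n‖ ≤ K / |(n : ℝ)|)
    (hcoeff : ∀ n : ℤ,
      (∫ t in (0:ℝ)..1, f t * Complex.exp (-(2 * Real.pi * Complex.I * n * t))) = c n) :
    TendstoUniformlyOn
      (fun N : ℕ => fun t : ℝ =>
        ∑ n ∈ Finset.Icc (-(N : ℤ)) (N : ℤ),
          c n * Complex.exp (2 * Real.pi * Complex.I * n * t))
      f Filter.atTop (Set.Icc 0 1) := by
  have hK : 0 ≤ K := by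
    have := hdecay 1 one_ne_zero
    simp at this
    exact (norm_nonneg _).trans this
  have hcont : Continuous (AddCircle.liftIco (1:ℝ) 0 f) :=
    AddCircle.liftIco_continuous (by simpa using hper) (by simpa using hf)
  let g : FUC.E := ⟨AddCircle.liftIco (1:ℝ) 0 f, hcont⟩
  have hg : ∀ n, fourierCoeff g n = c n := by
    intro n
    change fourierCoeff (AddCircle.liftIco (1:ℝ) 0 f) n = c n
    rw [fourierCoeff_liftIco_eq, fourierCoeffOn_eq_integral, ← hcoeff n]
    simp only [zero_add, sub_zero, div_one, one_smul]
    congr 1; ext t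
    rw [fourier_coe_apply, smul_eq_mul, mul_comm]
    congr 2
    push_cast; simp
  have hgf : ∀ t ∈ Set.Icc (0:ℝ) 1, g (t : AddCircle (1:ℝ)) = f t := by
    intro t ht
    change AddCircle.liftIco (1:ℝ) 0 f t = f t
    rcases eq_or_lt_of_le ht.2 with h | h
    · subst h
      have : ((1:ℝ) : AddCircle (1:ℝ)) = ((0:ℝ) : AddCircle (1:ℝ)) := by
        rw [AddCircle.coe_period]; rfl
      rw [this, AddCircle.liftIco_coe_apply (by simp), hper]
    · exact AddCircle.liftIco_coe_apply (by simpa using ⟨ht.1, h⟩)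
  rw [Metric.tendstoUniformlyOn_iff]
  intro ε hε
  obtain ⟨N0, hN0⟩ := FUC.conv g K hK (fun n hn => by rw [hg]; exact hdecay n hn) ε hε
  filter_upwards [Filter.eventually_ge_atTop N0] with N hN t ht
  have e : ∑ n ∈ Finset.Icc (-(N : ℤ)) (N : ℤ), c n * Complex.exp (2 * Real.pi * Complex.I * n * t)
      = FUC.S N g (t : AddCircle (1:ℝ)) := by
    simp [FUC.S, ContinuousMap.sum_apply, hg, fourier_coe_apply]
  rw [e, ← hgf t ht, dist_comm, dist_eq_norm]
  exact lt_of_le_of_lt ((FUC.S N g - g).norm_coe_le_norm t) (hN0 N hN)
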